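/- Let 2 < q < p ≤ 6 and α > 0. (i) If either p < 6 and μ > 0, or p = 6 and 0 < μ < μ_ℝ, then E_{p,q,α} is bounded from below on H¹_μ(ℝ) and is coercive there: every sequence (u_n) ⊂ H¹_μ(ℝ) with sup_n E_{p,q,α}(u_n) < ∞ satisfies sup_n ∫_ℝ |u_n′|² dx < ∞. (ii) If p = 6 and μ ≥ μ_ℝ, then 𝓔_{6,q,α}(μ) = −∞. -/

import Mathlib

open MeasureTheory

/-- The NLS energy with combined nonlinearities on the real line. -/
noncomputable def NLSenergy (p q α : ℝ) (u : ℝ → ℝ) : ℝ :=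
  ∫ x : ℝ, ((1 / 2) * (deriv u x) ^ 2 - (1 / p) * |u x| ^ p - (α / q) * |u x| ^ q)

/-- Membership in H¹_μ(ℝ): differentiable, u and u′ square-integrable, mass μ. -/
def InH1mass (μ : ℝ) (u : ℝ → ℝ) : Prop :=
  Differentiable ℝ u ∧ (Integrable fun x => (u x) ^ 2) ∧
    (Integrable fun x => (deriv u x) ^ 2) ∧ (∫ x : ℝ, (u x) ^ 2) = μ

/-- The ground-state energy level 𝓔_{p,q,α}(μ), as an extended real number. -/
noncomputable def groundLevel (p q α μ : ℝ) : EReal :=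
  sInf ((fun u : ℝ → ℝ => ((NLSenergy p q α u : ℝ) :  EReal)) '' {u | InH1mass μ u})

/-- The critical mass of the real line: μ_ℝ = (√3/2)π. -/
noncomputable def muR : ℝ := Real.sqrt 3 / 2 * Real.pi

open Filter Topology Set

namespace InH1mass

variable {μ : ℝ} {u : ℝ → ℝ}

lemma continuous (hu : InH1mass μ u) : Continuous u := hu.1.continuous

lemma hasDerivAt (hu : InH1mass μ u) (x : ℝ) : HasDerivAt u (deriv u x) x :=
  (hu.1 x).hasDerivAt

lemma integrable_mul_deriv (hu : InH1mass μ u) : Integrable fun x => u x * deriv u x := by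
  refine (hu.2.1.add hu.2.2.1).mono'
    (hu.continuous.aestronglyMeasurable.mul (measurable_deriv u).aestronglyMeasurable) ?_
  filter_upwards with x
  rw [Real.norm_eq_abs, abs_le]
  simp only [Pi.add_apply]
  constructor <;> nlinarith [sq_nonneg (u x + deriv u x), sq_nonneg (u x - deriv u x)]

lemma hasDerivAt_sq (hu : InH1mass μ u) (x : ℝ) :
    HasDerivAt (fun y => u y ^ 2) (2 * (u x * deriv u x)) x :=
  ((hu.hasDerivAt x).pow 2).congr_deriv (by norm_num; ring)

lemma tendsto_sq_atTop (hu : InH1mass μ u) : Tendsto (fun x => u x ^ 2) atTop (𝓝 0) :=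
  tendsto_zero_of_hasDerivAt_of_integrableOn_Ioi (a := 0) (fun x _ => hu.hasDerivAt_sq x)
    (hu.integrable_mul_deriv.const_mul 2).integrableOn hu.2.1.integrableOn

lemma tendsto_sq_atBot (hu : InH1mass μ u) : Tendsto (fun x => u x ^ 2) atBot (𝓝 0) :=
  tendsto_zero_of_hasDerivAt_of_integrableOn_Iic (a := 0) (fun x _ => hu.hasDerivAt_sq x)
    (hu.integrable_mul_deriv.const_mul 2).integrableOn hu.2.1.integrableOn

lemma exists_abs_le (hu : InH1mass μ u) : ∃ K, 0 ≤ K ∧ ∀ x, |u x| ≤ K := by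
  have hi := hu.integrable_mul_deriv.const_mul 2
  refine ⟨√(∫ x, ‖2 * (u x * deriv u x)‖), Real.sqrt_nonneg _, fun x => Real.abs_le_sqrt ?_⟩
  have h := integral_Iic_of_hasDerivAt_of_tendsto' (a := x) (fun y _ => hu.hasDerivAt_sq y)
    hi.integrableOn hu.tendsto_sq_atBot
  rw [sub_zero] at h
  rw [← h]
  exact (le_abs_self _).trans ((norm_integral_le_integral_norm _).trans
    (setIntegral_le_integral hi.norm (ae_of_all _ fun _ => norm_nonneg _)))

lemma integrable_abs_rpow (hu : InH1mass μ u) {r : ℝ} (hr : 2 ≤ r) :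
    Integrable fun x => |u x| ^ r := by
  obtain ⟨K, hK, hb⟩ := hu.exists_abs_le
  have hcont : Continuous fun x => |u x| ^ r :=
    hu.continuous.abs.rpow_const fun _ => Or.inr (by linarith)
  refine (hu.2.1.const_mul (K ^ (r - 2))).mono' hcont.aestronglyMeasurable ?_
  filter_upwards with x
  rw [Real.norm_of_nonneg (Real.rpow_nonneg (abs_nonneg _) _)]
  have h : |u x| ^ r = |u x| ^ (r - 2) * u x ^ 2 := by
    rw [← sq_abs (u x), ← Real.rpow_natCast, ← Real.rpow_add_of_nonneg (abs_nonneg _)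
      (by linarith) (by norm_num)]
    norm_num
  rw [h]
  have := Real.rpow_le_rpow (abs_nonneg _) (hb x) (by linarith : 0 ≤ r - 2)
  gcongr

lemma integrable_pow_six (hu : InH1mass μ u) : Integrable fun x => u x ^ 6 := by
  have h := hu.integrable_abs_rpow (r := 6) (by norm_num)
  refine h.congr (ae_of_all _ fun x => ?_)
  change |u x| ^ (6 : ℝ) = u x ^ 6
  rw [show (6 : ℝ) = ((6 : ℕ) : ℝ) by norm_num, Real.rpow_natCast, Even.pow_abs (by decide)]

lemma mass_nonneg (hu : InH1mass μ u) : 0 ≤ μ :=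
  hu.2.2.2 ▸ integral_nonneg fun _ => sq_nonneg _

lemma NLSenergy_eq (hu : InH1mass μ u) {p q : ℝ} (hp : 2 ≤ p) (hq : 2 ≤ q) (α : ℝ) :
    NLSenergy p q α u = (1 / 2) * (∫ x, deriv u x ^ 2) - (1 / p) * (∫ x, |u x| ^ p) -
      (α / q) * ∫ x, |u x| ^ q := by
  have h1 := hu.2.2.1.const_mul (1 / 2)
  have h2 := (hu.integrable_abs_rpow hp).const_mul (1 / p)
  have h3 := (hu.integrable_abs_rpow hq).const_mul (α / q)
  rw [NLSenergy, integral_sub (by exact h1.sub h2) h3, integral_sub h1 h2, integral_const_mul,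
    integral_const_mul, integral_const_mul]

/-- The mass to the left of `x`, centred so that it takes values in `[-μ / 2, μ / 2]`. -/
lemma exists_centred_mass (hu : InH1mass μ u) :
    ∃ M : ℝ → ℝ, (∀ x, HasDerivAt M (u x ^ 2) x) ∧ ∀ x, |M x| ≤ μ / 2 := by
  refine ⟨fun x => (∫ y in Iic x, u y ^ 2) - μ / 2, fun x => ?_, fun x => ?_⟩
  · have hcont : Continuous fun y => u y ^ 2 := hu.continuous.pow 2
    have h := intervalIntegral.integral_hasDerivAt_right (a := 0) (b := x)
      (hcont.intervalIntegrable _ _)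
      (hcont.aestronglyMeasurable.stronglyMeasurableAtFilter) hcont.continuousAt
    have heq : (fun z => (∫ y in Iic z, u y ^ 2) - μ / 2) =
        fun z => (∫ y in (0 : ℝ)..z, u y ^ 2) + ((∫ y in Iic 0, u y ^ 2) - μ / 2) := by
      funext z
      rw [← intervalIntegral.integral_Iic_sub_Iic hu.2.1.integrableOn hu.2.1.integrableOn]
      ring
    rw [heq]
    exact h.add_const _
  · have h0 : 0 ≤ ∫ y in Iic x, u y ^ 2 := integral_nonneg fun _ => sq_nonneg _
    have h1 : ∫ y in Iic x, u y ^ 2 ≤ ∫ y, u y ^ 2 :=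
      setIntegral_le_integral hu.2.1 (ae_of_all _ fun _ => sq_nonneg _)
    rw [hu.2.2.2] at h1
    rw [abs_le]
    constructor <;> linarith

/-- The sharp Gagliardo–Nirenberg inequality on the line, up to an arbitrarily small loss. It is
Wirtinger's inequality in the variable given by the cumulative mass. -/
lemma sq_mul_integral_pow_six_le (hu : InH1mass μ u) {k : ℝ} (hk : 0 < k)
    (hkμ : k * μ < Real.pi) : k ^ 2 * (∫ x, u x ^ 6) ≤ 4 * ∫ x, deriv u x ^ 2 := by
  obtain ⟨M, hM, hMb⟩ := hu.exists_centred_mass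
  have hMc : Continuous M := continuous_iff_continuousAt.2 fun x => (hM x).continuousAt
  have hμ := hu.mass_nonneg
  set c := Real.cos (k * (μ / 2)) with hc
  have hc0 : 0 < c := Real.cos_pos_of_mem_Ioo
    ⟨by linarith [Real.pi_pos, mul_nonneg hk.le hμ], by linarith⟩
  have hcos : ∀ x, c ≤ Real.cos (k * M x) := fun x => by
    rw [← Real.cos_abs (k * M x), abs_mul, abs_of_pos hk]
    exact Real.cos_le_cos_of_nonneg_of_le_pi (by positivity) (by
        linarith [Real.pi_pos, mul_nonneg hk.le hμ]) (by gcongr; exact hMb x)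
  have hcos0 : ∀ x, Real.cos (k * M x) ≠ 0 := fun x => (hc0.trans_le (hcos x)).ne'
  have htan_le : ∀ x, |Real.tan (k * M x)| ≤ 1 / c := fun x => by
    rw [Real.tan_eq_sin_div_cos, abs_div, abs_of_pos (hc0.trans_le (hcos x))]
    exact div_le_div₀ zero_le_one (Real.abs_sin_le_one _) hc0 (hcos x)
  have htan_cont : Continuous fun x => Real.tan (k * M x) :=
    continuous_iff_continuousAt.2 fun x =>
      (Real.continuousAt_tan.2 (hcos0 x)).comp (f := fun x => k * M x)
        (hMc.const_mul k).continuousAt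
  obtain ⟨K, hK, hub⟩ := hu.exists_abs_le
  set T : ℝ → ℝ := fun x => Real.tan (k * M x) with hT
  have hderiv : ∀ x, HasDerivAt (fun y => T y * u y ^ 4)
      (k * (1 + T x ^ 2) * u x ^ 6 + 4 * (T x * u x ^ 2 * (u x * deriv u x))) x := fun x => by
    have h1 := (Real.hasDerivAt_tan (hcos0 x)).comp x ((hM x).const_mul k)
    refine (h1.mul ((hu.hasDerivAt x).pow 4)).congr_deriv ?_
    have h2 : 1 / Real.cos (k * M x) ^ 2 = 1 + T x ^ 2 := by
      rw [one_div, ← Real.inv_one_add_tan_sq (hcos0 x), inv_inv]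
    simp only [h2, Function.comp_apply, Pi.pow_apply]
    simp only [hT]
    push_cast
    ring
  have hlim : ∀ l : Filter ℝ, Tendsto (fun x => u x ^ 2) l (𝓝 0) →
      Tendsto (fun x => T x * u x ^ 4) l (𝓝 0) := fun l hl => by
    refine bdd_le_mul_tendsto_zero' (1 / c) (Eventually.of_forall htan_le) ?_
    have := hl.mul hl
    rw [mul_zero] at this
    exact this.congr fun x => by ring
  have hi6 : Integrable fun x => k * (1 + T x ^ 2) * u x ^ 6 := by
    refine hu.integrable_pow_six.bdd_mul (c := k * (1 + (1 / c) ^ 2))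
      (by fun_prop) (ae_of_all _ fun x => ?_)
    rw [Real.norm_of_nonneg (by positivity), ← sq_abs (T x)]
    have := htan_le x
    gcongr
  have hi3 : Integrable fun x => T x * u x ^ 2 * (u x * deriv u x) := by
    have := hu.continuous
    refine hu.integrable_mul_deriv.bdd_mul (c := 1 / c * K ^ 2)
      (by fun_prop) (ae_of_all _ fun x => ?_)
    rw [norm_mul, norm_pow]
    have h1 := htan_le x
    have h2 := hub x
    simp only [Real.norm_eq_abs]
    gcongr
  have hzero := integral_of_hasDerivAt_of_tendsto hderiv (hi6.add (hi3.const_mul 4))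
    (hlim _ hu.tendsto_sq_atBot) (hlim _ hu.tendsto_sq_atTop)
  have hnn : 0 ≤ ∫ x, (4 * deriv u x ^ 2 - k ^ 2 * u x ^ 6 +
      k * (k * (1 + T x ^ 2) * u x ^ 6 + 4 * (T x * u x ^ 2 * (u x * deriv u x)))) := by
    refine integral_nonneg fun x => ?_
    have : 4 * deriv u x ^ 2 - k ^ 2 * u x ^ 6 +
        k * (k * (1 + T x ^ 2) * u x ^ 6 + 4 * (T x * u x ^ 2 * (u x * deriv u x))) =
        (2 * deriv u x + k * T x * u x ^ 3) ^ 2 := by ring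
    simp only [this]
    positivity
  have h4 := hu.2.2.1.const_mul 4
  have h6 := hu.integrable_pow_six.const_mul (k ^ 2)
  rw [integral_add (by exact h4.sub h6) (by exact (hi6.add (hi3.const_mul 4)).const_mul k),
    integral_sub h4 h6, integral_const_mul, integral_const_mul, integral_const_mul] at hnn
  rw [hzero] at hnn
  linarith

end InH1mass

lemma exists_rpow_le_mul_pow_six_add {r : ℝ} (h2 : 2 < r) (h6 : r < 6) {ε : ℝ} (hε : 0 < ε) :
    ∃ B : ℝ, ∀ t : ℝ, 0 ≤ t → t ^ r ≤ ε * t ^ 6 + B * t ^ 2 := by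
  set T : ℝ := ε ^ (1 / (r - 6)) with hT
  have hT0 : 0 < T := Real.rpow_pos_of_pos hε _
  refine ⟨T ^ (r - 2), fun t ht => ?_⟩
  rcases le_total T t with h | h
  · have ht0 : 0 < t := hT0.trans_le h
    have h1 : t ^ r = t ^ (r - 6) * t ^ 6 := by
      rw [← Real.rpow_natCast t 6, ← Real.rpow_add ht0]
      norm_num
    have hTε : T ^ (r - 6) = ε := by
      rw [hT, ← Real.rpow_mul hε.le, one_div_mul_cancel (by linarith), Real.rpow_one]
    have h3 : t ^ (r - 6) ≤ ε := by
      rw [← hTε]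
      exact Real.rpow_le_rpow_of_nonpos hT0 h (by linarith)
    have h4 : 0 ≤ T ^ (r - 2) * t ^ 2 := by positivity
    rw [h1]
    nlinarith [mul_le_mul_of_nonneg_right h3 (by positivity : 0 ≤ t ^ 6)]
  · have h1 : t ^ r = t ^ (r - 2) * t ^ 2 := by
      rw [← Real.rpow_natCast t 2, ← Real.rpow_add_of_nonneg ht (by linarith) (by norm_num)]
      norm_num
    have h3 : t ^ (r - 2) ≤ T ^ (r - 2) := Real.rpow_le_rpow ht h (by linarith)
    have h4 : 0 ≤ ε * t ^ 6 := by positivity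
    rw [h1]
    nlinarith [mul_le_mul_of_nonneg_right h3 (by positivity : 0 ≤ t ^ 2)]

/-- The two nonlinearities are dominated by a multiple of `t ^ 6` which is small enough for the
Gagliardo–Nirenberg inequality at mass `μ`. -/
lemma exists_nonlinearity_le {p q α μ : ℝ} (hq : 2 < q) (hqp : q < p) (hα : 0 < α)
    (h : (p < 6 ∧ 0 < μ) ∨ (p = 6 ∧ 0 < μ ∧ μ < muR)) :
    ∃ k a B : ℝ, 0 < k ∧ k * μ < Real.pi ∧ 0 ≤ a ∧ 8 * a < k ^ 2 ∧
      ∀ t : ℝ, 0 ≤ t → (1 / p) * t ^ p + (α / q) * t ^ q ≤ a * t ^ 6 + B * t ^ 2 := by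
  have hq0 : 0 < q := by linarith
  have hp0 : 0 < p := by linarith
  rcases h with ⟨hp, hμ⟩ | ⟨rfl, hμ, hμR⟩
  · set k := Real.pi / (2 * μ) with hk
    have hk0 : 0 < k := div_pos Real.pi_pos (by linarith)
    obtain ⟨B₁, hB₁⟩ := exists_rpow_le_mul_pow_six_add (hq.trans hqp) hp
      (ε := p * (k ^ 2 / 32)) (by positivity)
    obtain ⟨B₂, hB₂⟩ := exists_rpow_le_mul_pow_six_add hq (hqp.trans hp)
      (ε := q / α * (k ^ 2 / 32)) (by positivity)
    refine ⟨k, k ^ 2 / 16, 1 / p * B₁ + α / q * B₂, hk0, ?_, by positivity, ?_, fun t ht => ?_⟩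
    · rw [hk, div_mul_eq_mul_div, div_lt_iff₀ (by positivity)]
      nlinarith [Real.pi_pos, mul_pos Real.pi_pos hμ]
    · nlinarith [pow_pos hk0 2]
    · calc (1 / p) * t ^ p + (α / q) * t ^ q
          ≤ (1 / p) * (p * (k ^ 2 / 32) * t ^ 6 + B₁ * t ^ 2) +
            (α / q) * (q / α * (k ^ 2 / 32) * t ^ 6 + B₂ * t ^ 2) := by
            have := hB₁ t ht
            have := hB₂ t ht
            gcongr
        _ = _ := by
            field_simp
            ring
  · have h3 : 0 < √3 := by positivity
    have h33 : √3 ^ 2 = 3 := Real.sq_sqrt (by norm_num)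
    obtain ⟨k, hk1, hk2⟩ := exists_between (show 2 / √3 < Real.pi / μ by
      rw [muR] at hμR
      rw [div_lt_div_iff₀ h3 hμ]
      linarith)
    have hk0 : 0 < k := lt_trans (by positivity) hk1
    have hk43 : 4 / 3 < k ^ 2 := by
      have := pow_lt_pow_left₀ hk1 (by positivity) two_ne_zero
      rw [div_pow, h33] at this
      linarith
    obtain ⟨B, hB⟩ := exists_rpow_le_mul_pow_six_add hq hqp
      (ε := q / α * ((k ^ 2 - 4 / 3) / 16)) (mul_pos (by positivity) (by linarith))
    refine ⟨k, 1 / 6 + (k ^ 2 - 4 / 3) / 16, α / q * B, hk0, (lt_div_iff₀ hμ).1 hk2,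
      by linarith, by linarith, fun t ht => ?_⟩
    have h6 : t ^ (6 : ℝ) = t ^ 6 := by
      rw [show (6 : ℝ) = ((6 : ℕ) : ℝ) by norm_num, Real.rpow_natCast]
    rw [h6]
    calc (1 / 6) * t ^ 6 + (α / q) * t ^ q
        ≤ (1 / 6) * t ^ 6 + (α / q) * (q / α * ((k ^ 2 - 4 / 3) / 16) * t ^ 6 + B * t ^ 2) := by
          have := hB t ht
          gcongr
      _ = _ := by
          field_simp
          ring

lemma exists_energy_ge {p q α μ : ℝ} (hq : 2 < q) (hqp : q < p) (hα : 0 < α)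
    (h : (p < 6 ∧ 0 < μ) ∨ (p = 6 ∧ 0 < μ ∧ μ < muR)) :
    ∃ c C : ℝ, 0 < c ∧ ∀ u : ℝ → ℝ, InH1mass μ u →
      c * (∫ x, deriv u x ^ 2) - C ≤ NLSenergy p q α u := by
  obtain ⟨k, a, B, hk, hkμ, ha, hak, hle⟩ := exists_nonlinearity_le hq hqp hα h
  refine ⟨1 / 2 - 4 * a / k ^ 2, B * μ, ?_, fun u hu => ?_⟩
  · rw [sub_pos, div_lt_div_iff₀ (by positivity) (by norm_num)]
    linarith
  have h2 := (hu.integrable_abs_rpow (hq.trans hqp).le).const_mul (1 / p)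
  have h3 := (hu.integrable_abs_rpow hq.le).const_mul (α / q)
  have h6 := hu.integrable_pow_six.const_mul a
  have hm := hu.2.1.const_mul B
  have hmono : ∫ x, ((1 / p) * |u x| ^ p + (α / q) * |u x| ^ q) ≤
      ∫ x, (a * u x ^ 6 + B * u x ^ 2) := by
    refine integral_mono (h2.add h3) (h6.add hm) fun x => ?_
    have := hle |u x| (abs_nonneg _)
    rwa [sq_abs, Even.pow_abs (by decide)] at this
  rw [integral_add h2 h3, integral_add h6 hm, integral_const_mul, integral_const_mul,
    integral_const_mul, integral_const_mul, hu.2.2.2] at hmono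
  have hGN := hu.sq_mul_integral_pow_six_le hk hkμ
  have h7 : a * (∫ x, u x ^ 6) ≤ 4 * a / k ^ 2 * ∫ x, deriv u x ^ 2 := by
    rw [div_mul_eq_mul_div, le_div_iff₀ (by positivity)]
    nlinarith [mul_le_mul_of_nonneg_left hGN ha]
  rw [hu.NLSenergy_eq (hq.trans hqp).le hq.le]
  linarith

/-- The critical soliton, with mass `π`. -/
noncomputable def soliton (x : ℝ) : ℝ := (√(Real.cosh x))⁻¹

lemma soliton_pos (x : ℝ) : 0 < soliton x := inv_pos.2 (Real.sqrt_pos.2 (Real.cosh_pos x))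

lemma soliton_sq (x : ℝ) : soliton x ^ 2 = (Real.cosh x)⁻¹ := by
  rw [soliton, inv_pow, Real.sq_sqrt (Real.cosh_pos x).le]

lemma hasDerivAt_soliton (x : ℝ) :
    HasDerivAt soliton (-(Real.sinh x / (2 * √(Real.cosh x))) / √(Real.cosh x) ^ 2) x :=
  ((Real.hasDerivAt_cosh x).sqrt (Real.cosh_pos x).ne').inv
    (Real.sqrt_pos.2 (Real.cosh_pos x)).ne'

lemma deriv_soliton_sq (x : ℝ) :
    deriv soliton x ^ 2 = (1 / 4) * ((Real.cosh x)⁻¹ - (Real.cosh x)⁻¹ ^ 3) := by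
  have h := Real.cosh_pos x
  rw [(hasDerivAt_soliton x).deriv, div_pow, neg_sq, div_pow, mul_pow, Real.sq_sqrt h.le,
    Real.sinh_sq]
  field_simp
  ring

lemma one_add_sq_le_four_mul_cosh (x : ℝ) : 1 + x ^ 2 ≤ 4 * Real.cosh x := by
  have h := Real.quadratic_le_exp_of_nonneg (abs_nonneg x)
  rw [sq_abs] at h
  rw [← Real.cosh_abs, Real.cosh_eq]
  nlinarith [Real.exp_pos (-|x|), abs_nonneg x]

lemma integrable_inv_cosh : Integrable fun x => (Real.cosh x)⁻¹ := by
  refine (integrable_inv_one_add_sq.const_mul 4).mono'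
    (Real.continuous_cosh.inv₀ fun x => (Real.cosh_pos x).ne').aestronglyMeasurable
    (ae_of_all _ fun x => ?_)
  have h := Real.cosh_pos x
  rw [Real.norm_of_nonneg (by positivity), ← div_eq_mul_inv, inv_eq_one_div,
    div_le_div_iff₀ h (by positivity)]
  linarith [one_add_sq_le_four_mul_cosh x]

lemma integrable_inv_cosh_pow_three : Integrable fun x => (Real.cosh x)⁻¹ ^ 3 := by
  refine integrable_inv_cosh.mono'
    ((Real.continuous_cosh.inv₀ fun x => (Real.cosh_pos x).ne').pow 3).aestronglyMeasurable
    (ae_of_all _ fun x => ?_)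
  have h := Real.cosh_pos x
  rw [Real.norm_of_nonneg (by positivity)]
  exact pow_le_of_le_one (by positivity) (inv_le_one_of_one_le₀ (Real.one_le_cosh x))
    three_ne_zero

lemma tendsto_sinh_atTop : Tendsto Real.sinh atTop atTop :=
  tendsto_atTop_mono' _ ((eventually_ge_atTop 0).mono fun _ => Real.self_le_sinh_iff.2) tendsto_id

lemma tendsto_sinh_atBot : Tendsto Real.sinh atBot atBot := by
  have h := tendsto_neg_atTop_atBot.comp (tendsto_sinh_atTop.comp tendsto_neg_atBot_atTop)
  exact h.congr fun x => by simp

lemma integral_inv_cosh : ∫ x, (Real.cosh x)⁻¹ = Real.pi := by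
  have hd : ∀ x, HasDerivAt (fun y => Real.arctan (Real.sinh y)) (Real.cosh x)⁻¹ x := fun x => by
    refine (Real.hasDerivAt_sinh x).arctan.congr_deriv ?_
    have h := Real.cosh_pos x
    rw [add_comm, ← Real.cosh_sq]
    field_simp
  rw [integral_of_hasDerivAt_of_tendsto hd integrable_inv_cosh
    ((tendsto_nhds_of_tendsto_nhdsWithin Real.tendsto_arctan_atBot).comp tendsto_sinh_atBot)
    ((tendsto_nhds_of_tendsto_nhdsWithin Real.tendsto_arctan_atTop).comp tendsto_sinh_atTop)]
  ring

lemma integral_inv_cosh_pow_three : ∫ x, (Real.cosh x)⁻¹ ^ 3 = Real.pi / 2 := by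
  have hd : ∀ x, HasDerivAt (fun y => Real.sinh y / Real.cosh y ^ 2)
      (2 * (Real.cosh x)⁻¹ ^ 3 - (Real.cosh x)⁻¹) x := fun x => by
    have h := Real.cosh_pos x
    refine ((Real.hasDerivAt_sinh x).div ((Real.hasDerivAt_cosh x).pow 2)
      (pow_pos h 2).ne').congr_deriv ?_
    simp only [Pi.pow_apply]
    field_simp
    push_cast
    ring_nf
    rw [Real.sinh_sq]
    ring
  have hb : ∀ x, ‖Real.sinh x / Real.cosh x ^ 2‖ ≤ 4 * (1 + x ^ 2)⁻¹ := fun x => by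
    have h := Real.cosh_pos x
    have hs : |Real.sinh x| ≤ Real.cosh x := by
      rw [abs_le]
      constructor <;> nlinarith [Real.cosh_add_sinh x, Real.cosh_sub_sinh x, Real.exp_pos x,
        Real.exp_pos (-x)]
    rw [norm_div, Real.norm_eq_abs, Real.norm_of_nonneg (by positivity), ← div_eq_mul_inv,
      div_le_div_iff₀ (by positivity) (by positivity)]
    calc |Real.sinh x| * (1 + x ^ 2) ≤ Real.cosh x * (4 * Real.cosh x) := by
          gcongr
          exact one_add_sq_le_four_mul_cosh x
      _ = _ := by ring
  have hlim : ∀ l : Filter ℝ, Tendsto (fun x : ℝ => x ^ 2) l atTop →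
      Tendsto (fun x => Real.sinh x / Real.cosh x ^ 2) l (𝓝 0) := fun l hl => by
    refine squeeze_zero_norm hb ?_
    simpa using (tendsto_atTop_add_const_left l 1 hl).inv_tendsto_atTop.const_mul 4
  have h3 := integrable_inv_cosh_pow_three.const_mul 2
  have h := integral_of_hasDerivAt_of_tendsto hd (h3.sub integrable_inv_cosh)
    (hlim _ (((tendsto_pow_atTop two_ne_zero).comp tendsto_neg_atBot_atTop).congr
      fun x => by simp))
    (hlim _ (tendsto_pow_atTop two_ne_zero))
  rw [integral_sub h3 integrable_inv_cosh, integral_const_mul, integral_inv_cosh] at h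
  linarith

lemma inH1mass_soliton : InH1mass Real.pi soliton := by
  refine ⟨fun x => (hasDerivAt_soliton x).differentiableAt, ?_, ?_, ?_⟩
  · simpa only [soliton_sq] using integrable_inv_cosh
  · simp only [deriv_soliton_sq]
    exact (integrable_inv_cosh.sub integrable_inv_cosh_pow_three).const_mul (1 / 4)
  · simpa only [soliton_sq] using integral_inv_cosh

lemma integral_deriv_soliton_sq : ∫ x, deriv soliton x ^ 2 = Real.pi / 8 := by
  simp only [deriv_soliton_sq]
  rw [integral_const_mul, integral_sub integrable_inv_cosh integrable_inv_cosh_pow_three,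
    integral_inv_cosh, integral_inv_cosh_pow_three]
  ring

lemma integral_abs_soliton_rpow_six : ∫ x, |soliton x| ^ (6 : ℝ) = Real.pi / 2 := by
  rw [← integral_inv_cosh_pow_three]
  congr 1 with x
  rw [← soliton_sq, show (6 : ℝ) = ((6 : ℕ) : ℝ) by norm_num, Real.rpow_natCast,
    Even.pow_abs (by decide)]
  ring

lemma integral_abs_soliton_rpow_pos {q : ℝ} (hq : 2 ≤ q) : 0 < ∫ x, |soliton x| ^ q := by
  have hpos : ∀ x, 0 < |soliton x| ^ q := fun x =>
    Real.rpow_pos_of_pos (abs_pos.2 (soliton_pos x).ne') _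
  rw [integral_pos_iff_support_of_nonneg (fun x => (hpos x).le)
    (inH1mass_soliton.integrable_abs_rpow hq)]
  rw [show Function.support (fun x => |soliton x| ^ q) = univ from
    eq_univ_of_forall fun x => (hpos x).ne']
  simp

section Rescaling

variable {m b l : ℝ} {w : ℝ → ℝ}

lemma deriv_rescaling (b l x : ℝ) (w : ℝ → ℝ) :
    deriv (fun x => b * w (l * x)) x = b * l * deriv w (l * x) := by
  rw [deriv_const_mul_field, deriv_comp_mul_left, smul_eq_mul]
  ring

lemma InH1mass.rescaling (hw : InH1mass m w) (b : ℝ) (hl : 0 < l) :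
    InH1mass (b ^ 2 / l * m) fun x => b * w (l * x) := by
  refine ⟨?_, ?_, ?_, ?_⟩
  · have := hw.1
    fun_prop
  · simp only [mul_pow]
    exact (hw.2.1.comp_mul_left' hl.ne').const_mul _
  · simp only [deriv_rescaling, mul_pow]
    exact (hw.2.2.1.comp_mul_left' hl.ne').const_mul _
  · simp only [mul_pow]
    rw [integral_const_mul, Measure.integral_comp_mul_left (fun x => w x ^ 2), hw.2.2.2,
      abs_of_pos (inv_pos.2 hl), smul_eq_mul]
    ring

lemma integral_deriv_rescaling_sq (w : ℝ → ℝ) (b : ℝ) (hl : 0 < l) :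
    ∫ x, deriv (fun x => b * w (l * x)) x ^ 2 = b ^ 2 * l * ∫ x, deriv w x ^ 2 := by
  simp only [deriv_rescaling, mul_pow]
  rw [integral_const_mul, Measure.integral_comp_mul_left (fun x => deriv w x ^ 2),
    abs_of_pos (inv_pos.2 hl), smul_eq_mul]
  field_simp

lemma integral_abs_rescaling_rpow (w : ℝ → ℝ) (hb : 0 ≤ b) (hl : 0 < l) (r : ℝ) :
    ∫ x, |b * w (l * x)| ^ r = b ^ r / l * ∫ x, |w x| ^ r := by
  simp only [abs_mul, abs_of_nonneg hb, Real.mul_rpow hb (abs_nonneg _)]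
  rw [integral_const_mul, Measure.integral_comp_mul_left (fun x => |w x| ^ r),
    abs_of_pos (inv_pos.2 hl), smul_eq_mul]
  ring

end Rescaling

lemma exists_energy_le {q α μ : ℝ} (hq : 2 < q) (hα : 0 < α) (hμ : muR ≤ μ) (R : ℝ) :
    ∃ u, InH1mass μ u ∧ NLSenergy 6 q α u ≤ R := by
  have hπ := Real.pi_pos
  set s := μ / Real.pi with hs
  have hsμ : s * Real.pi = μ := div_mul_cancel₀ _ hπ.ne'
  have hs3 : √3 / 2 ≤ s := by
    rw [hs, le_div_iff₀ hπ]
    exact hμ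
  have hs0 : 0 < s := lt_of_lt_of_le (by positivity) hs3
  have hs34 : 3 / 4 ≤ s ^ 2 := by
    have := pow_le_pow_left₀ (by positivity) hs3 2
    rw [div_pow, Real.sq_sqrt (by norm_num)] at this
    linarith
  set K := ∫ x, |soliton x| ^ q with hK
  have hK0 : 0 < K := integral_abs_soliton_rpow_pos hq.le
  have hlim : Tendsto (fun l : ℝ => α / q * (s ^ (q / 2) * l ^ (q / 2 - 1) * K)) atTop atTop :=
    (((tendsto_rpow_atTop (by linarith : 0 < q / 2 - 1)).const_mul_atTop
      (by positivity)).atTop_mul_const hK0).const_mul_atTop (by positivity)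
  obtain ⟨l, hlR, hl0⟩ := ((hlim.eventually_ge_atTop (-R)).and (eventually_gt_atTop 0)).exists
  have hb : 0 ≤ √(l * s) := Real.sqrt_nonneg _
  have hb2 : √(l * s) ^ 2 = l * s := Real.sq_sqrt (by positivity)
  have hmem : InH1mass μ fun x => √(l * s) * soliton (l * x) := by
    have h := inH1mass_soliton.rescaling √(l * s) hl0
    rwa [hb2, mul_div_cancel_left₀ _ hl0.ne', hsμ] at h
  refine ⟨_, hmem, ?_⟩
  rw [hmem.NLSenergy_eq (by norm_num) hq.le, integral_deriv_rescaling_sq _ _ hl0,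
    integral_abs_rescaling_rpow _ hb hl0, integral_abs_rescaling_rpow _ hb hl0,
    integral_deriv_soliton_sq, integral_abs_soliton_rpow_six, ← hK, hb2]
  have h6 : √(l * s) ^ (6 : ℝ) = (l * s) ^ 3 := by
    rw [show (6 : ℝ) = ((6 : ℕ) : ℝ) by norm_num, Real.rpow_natCast,
      show √(l * s) ^ 6 = (√(l * s) ^ 2) ^ 3 by ring, hb2]
  have hq' : √(l * s) ^ q / l = s ^ (q / 2) * l ^ (q / 2 - 1) := by
    rw [Real.sqrt_eq_rpow, ← Real.rpow_mul (by positivity), one_div_mul_eq_div,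
      Real.mul_rpow hl0.le hs0.le, Real.rpow_sub_one hl0.ne']
    ring
  have h63 : (l * s) ^ 3 / l = l ^ 2 * s ^ 3 := by
    field_simp
  rw [h6, hq', h63]
  have hle : 0 ≤ l ^ 2 * s * Real.pi / 12 * (s ^ 2 - 3 / 4) :=
    mul_nonneg (by positivity) (by linarith)
  nlinarith

/-- focusing case, boundedness/coercivity below the critical mass
and unboundedness at or above it (p = 6). -/
theorem focusing_boundedness_coercivity
    (p q α μ : ℝ) (hq : 2 < q) (hqp : q < p) (hp : p ≤ 6) (hα : 0 < α) :
    (((p < 6 ∧ 0 < μ) ∨ (p = 6 ∧ 0 < μ ∧ μ < muR)) →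
      (∃ C : ℝ, ∀ u : ℝ → ℝ, InH1mass μ u → C ≤ NLSenergy p q α u) ∧
      (∀ u : ℕ → ℝ → ℝ, (∀ n, InH1mass μ (u n)) →
        (∃ C : ℝ, ∀ n, NLSenergy p q α (u n) ≤ C) →
        ∃ C : ℝ, ∀ n, (∫ x : ℝ, (deriv (u n) x) ^ 2) ≤ C)) ∧
    (p = 6 → muR ≤ μ → groundLevel p q α μ = ⊥) := by
  refine ⟨fun h => ?_, ?_⟩
  · obtain ⟨c, C, hc, hE⟩ := exists_energy_ge hq hqp hα h
    refine ⟨⟨-C, fun u hu => ?_⟩, fun u hu ⟨D, hD⟩ => ⟨(D + C) / c, fun n => ?_⟩⟩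
    · have h0 : 0 ≤ c * ∫ x, deriv u x ^ 2 :=
        mul_nonneg hc.le (integral_nonneg fun _ => sq_nonneg _)
      linarith [hE u hu]
    · rw [le_div_iff₀ hc]
      linarith [hE _ (hu n), hD n]
  · rintro rfl hμ
    rw [EReal.eq_bot_iff_forall_lt]
    intro R
    obtain ⟨u, hu, hE⟩ := exists_energy_le hq hα hμ (R - 1)
    have hR : NLSenergy 6 q α u < R := by linarith
    have hle : groundLevel 6 q α μ ≤ (NLSenergy 6 q α u : EReal) := sInf_le ⟨u, hu, rfl⟩
    exact hle.trans_lt (EReal.coe_lt_coe_iff.2 hR)
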